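/- There is no total preorder ≾ on the integers ℤ satisfying all of the following three conditions (where a ≺ b means a ≾ b and not b ≾ a): (1) for all a, b, c ∈ ℤ with c ≠ 0, a ≺ b implies a ≺ b·c; (2) for all a, b, c ∈ ℤ, a ≺ b implies a ≺ b + c; (3) for all a ∈ ℤ, the set {b ∈ ℤ | b ≾ a} is finite. (Consequently, the semiring (ℤ, +, 0, ·, 1) associated with the theory AG of Abelian groups admits no such preorder, i.e., AG is not a restrictive monoidal theory.) -/

import Mathlib

/-- Example `AG:is:not:restrictive:lem`: there is no total
preorder `≾` on `ℤ` (reflexive, transitive, total) such that, writing `a ≺ b`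
for `a ≾ b ∧ ¬ b ≾ a`: (1) for all `a b c` with `c ≠ 0`, `a ≺ b` implies
`a ≺ b * c`; (2) for all `a b c`, `a ≺ b` implies `a ≺ b + c`; and (3) for all
`a`, the set `{b | b ≾ a}` is finite. Consequently, the semiring
`(ℤ, +, 0, ·, 1)` associated with the theory `AG` of Abelian groups admits no
such preorder, i.e., `AG` is not a restrictive monoidal theory. -/
theorem stmt19 :
    ¬ ∃ r : ℤ → ℤ → Prop,
      (∀ a : ℤ, r a a) ∧
      (∀ a b c : ℤ, r a b → r b c → r a c) ∧
      (∀ a b : ℤ, r a b ∨ r b a) ∧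
      (∀ a b c : ℤ, c ≠ 0 → (r a b ∧ ¬ r b a) → (r a (b * c) ∧ ¬ r (b * c) a)) ∧
      (∀ a b c : ℤ, (r a b ∧ ¬ r b a) → (r a (b + c) ∧ ¬ r (b + c) a)) ∧
      (∀ a : ℤ, {b : ℤ | r b a}.Finite) := by
  rintro ⟨r, hrefl, -, htotal, -, hadd, hfin⟩
  obtain ⟨b, hb⟩ := (hfin 0).exists_notMem
  have h := hadd 0 b (-b) ⟨(htotal 0 b).resolve_right hb, hb⟩
  rw [add_neg_cancel] at h
  exact h.2 (hrefl 0)
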